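/- Let (R, m) be a local equidimensional universally catenary Noetherian ring, let I be an ideal of R, let A = R[It, t^{-1}] ⊆ R[t, t^{-1}] be the extended Rees algebra of I, and let J be the A-ideal (It, t^{-1}). Then the height of J equals 1 + height I. -/

import Mathlib

/-- The height of an ideal: the infimum of the heights of the prime ideals containing it. -/
noncomputable def Ideal.heightE {R : Type*} [CommRing R] (I : Ideal R) : ℕ∞ :=
  ⨅ p ∈ {p : PrimeSpectrum R | I ≤ p.asIdeal}, Order.height p
/-- A ring is equidimensional if `dim R/p = dim R` for every minimal prime `p` of `R`. -/
def IsEquidimensional (R : Type*) [CommRing R] : Prop :=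
  ∀ p ∈ minimalPrimes R, ringKrullDim (R ⧸ p) = ringKrullDim R
/-- A ring is catenary if any two saturated chains of primes with the same endpoints
have the same length.  (A chain is saturated when each step is a covering relation.) -/
def IsCatenaryRing (R : Type*) [CommRing R] : Prop :=
  ∀ c₁ c₂ : LTSeries (PrimeSpectrum R), c₁.head = c₂.head → c₁.last = c₂.last →
    (∀ i : Fin c₁.length, c₁.toFun i.castSucc ⋖ c₁.toFun i.succ) →
    (∀ i : Fin c₂.length, c₂.toFun i.castSucc ⋖ c₂.toFun i.succ) →
    c₁.length = c₂.length

/-- A ring is universally catenary if every finitely generated `R`-algebra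
(i.e. every quotient of a polynomial ring over `R` in finitely many variables) is catenary. -/
def IsUniversallyCatenary (R : Type*) [CommRing R] : Prop :=
  ∀ (n : ℕ) (Q : Ideal (MvPolynomial (Fin n) R)), IsCatenaryRing (MvPolynomial (Fin n) R ⧸ Q)
/-- The extended Rees algebra `A = R[It, t⁻¹]` of an ideal `I`, as a subalgebra of the
Laurent polynomial ring `R[t, t⁻¹]`. -/
noncomputable def extendedReesAlgebra (R : Type*) [CommRing R] (I : Ideal R) :
    Subalgebra R (LaurentPolynomial R) :=
  Algebra.adjoin R ({LaurentPolynomial.T (-1)} ∪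
    {f | ∃ a ∈ I, f = LaurentPolynomial.C a * LaurentPolynomial.T 1})

/-- The ideal `J = (It, t⁻¹)` of the extended Rees algebra `A = R[It, t⁻¹]`. -/
noncomputable def extendedReesIdealJ (R : Type*) [CommRing R] (I : Ideal R) :
    Ideal (extendedReesAlgebra R I) :=
  Ideal.span {x : extendedReesAlgebra R I |
    (x : LaurentPolynomial R) = LaurentPolynomial.T (-1) ∨
    ∃ a ∈ I, (x : LaurentPolynomial R) = LaurentPolynomial.C a * LaurentPolynomial.T 1}

section Aux

open Polynomial

attribute [local instance] Polynomial.algebra Polynomial.isLocalization in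
/-- A prime of `R[X]` has height at most one more than its contraction. -/
lemma aux_height_polynomial_le {R : Type*} [CommRing R] [IsNoetherianRing R]
    (P : Ideal R[X]) [P.IsPrime] : P.height ≤ (P.under R).height + 1 := by
  set p := P.under R with hp
  have : p.IsPrime := by rw [hp]; infer_instance
  have : P.LiesOver p := ⟨rfl⟩
  let Rₚ := Localization.AtPrime p
  set p' : Ideal Rₚ := p.map (algebraMap R Rₚ) with p'_def
  have hp'max : p'.IsMaximal := by
    rw [p'_def, Localization.AtPrime.map_eq_maximalIdeal]
    exact IsLocalRing.maximalIdeal.isMaximal Rₚ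
  let P' : Ideal Rₚ[X] := P.map (algebraMap R[X] Rₚ[X])
  have disj : Disjoint (p.primeCompl.map (C : R →+* R[X]) : Set R[X]) P := by
    refine Set.disjoint_left.mpr fun a ⟨b, hb⟩ ha ↦ hb.1 ?_
    rwa [SetLike.mem_coe, Ideal.LiesOver.over (P := P) (p := p), Ideal.mem_comap,
      Polynomial.algebraMap_eq, hb.2]
  have hP' : P'.IsPrime := IsLocalization.isPrime_of_isPrime_disjoint _ _ _ ‹_› disj
  have hlies : P'.LiesOver p' :=
    IsLocalization.liesOver_of_isPrime_of_disjoint p.primeCompl _ _ disj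
  obtain ⟨M, hM, hPM⟩ := P'.exists_le_maximal hP'.ne_top
  have : M.LiesOver p' := by
    refine ⟨hp'max.eq_of_le (Ideal.IsPrime.ne_top inferInstance) ?_⟩
    rw [hlies.over]
    exact Ideal.comap_mono hPM
  have eq1 : p.height = p'.height := by
    rw [IsLocalization.height_map_of_disjoint p.primeCompl]
    exact Disjoint.symm <| Set.disjoint_left.mpr fun _ a b ↦ b a
  have eq2 : P.height = P'.height := by
    rw [IsLocalization.height_map_of_disjoint (Submonoid.map C <| p.primeCompl) _ disj]
  rw [eq1, eq2, ← Polynomial.height_eq_height_add_one p' M]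
  exact Ideal.height_mono hPM

lemma aux_orderHeight_polynomial_le {R : Type*} [CommRing R] [IsNoetherianRing R]
    (P : PrimeSpectrum R[X]) :
    Order.height P ≤ Order.height (PrimeSpectrum.comap (C : R →+* R[X]) P) + 1 := by
  rw [← PrimeSpectrum.height_eq_orderHeight, ← PrimeSpectrum.height_eq_orderHeight]
  exact aux_height_polynomial_le P.asIdeal

lemma aux_height_comap_surj {S T : Type*} [CommRing S] [CommRing T] (φ : S →+* T)
    (hφ : Function.Surjective φ) (P : PrimeSpectrum T) :
    Order.height P ≤ Order.height (PrimeSpectrum.comap φ P) :=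
  Order.height_le_height_apply_of_strictMono _
    (RingHom.strictMono_comap_of_surjective hφ) P

lemma aux_height_comap_surj_succ {S T : Type*} [CommRing S] [CommRing T] (φ : S →+* T)
    (hφ : Function.Surjective φ) {x : S} (hx : x ∈ nonZeroDivisors S) (hx0 : φ x = 0)
    (P : PrimeSpectrum T) :
    Order.height P + 1 ≤ Order.height (PrimeSpectrum.comap φ P) := by
  have hne : Nonempty { p : LTSeries (PrimeSpectrum T) // p.last = P } :=
    ⟨RelSeries.singleton _ P, rfl⟩
  rw [Order.height_eq_iSup_last_eq, iSup_subtype', ENat.iSup_add]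
  refine iSup_le fun ⟨l, hl⟩ ↦ ?_
  let l' := l.map (PrimeSpectrum.comap φ) (RingHom.strictMono_comap_of_surjective hφ)
  obtain ⟨p, hp, hp'⟩ := Ideal.exists_minimalPrimes_le (J := l'.head.asIdeal) bot_le
  let p' : PrimeSpectrum S := ⟨p, hp.1.1⟩
  have hp' : p' < l'.head := lt_of_le_of_ne hp' fun h ↦ Set.disjoint_iff.mp
    (Ideal.disjoint_nonZeroDivisors_of_mem_minimalPrimes hp)
    ⟨show x ∈ p'.asIdeal by rw [h]; simp [l', hx0], hx⟩
  have := Order.length_le_height (p := l'.cons p' hp') (x := PrimeSpectrum.comap φ P)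
    (by simp [l', hl])
  simpa [l'] using this

/-- `C` satisfies the dimension bound over `R`. -/
def AuxBound (R C : Type*) [CommRing R] [CommRing C] [Algebra R C] : Prop :=
  ∀ P : PrimeSpectrum C,
    Order.height P ≤ Order.height (PrimeSpectrum.comap (algebraMap R C) P) + 1

lemma AuxBound.step {R C D : Type*} [CommRing R] [CommRing C] [CommRing D]
    [IsNoetherianRing C] [Algebra R C] [Algebra R D] (hC : AuxBound R C)
    (φ : C[X] →+* D) (hφ : Function.Surjective φ)
    (hcomp : φ.comp (Polynomial.C.comp (algebraMap R C)) = algebraMap R D)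
    {x : C[X]} (hx : x ∈ nonZeroDivisors C[X]) (hx0 : φ x = 0) : AuxBound R D := by
  intro P
  have h1 := aux_height_comap_surj_succ φ hφ hx hx0 P
  have h2 := aux_orderHeight_polynomial_le (PrimeSpectrum.comap φ P)
  have h3 := hC (PrimeSpectrum.comap Polynomial.C (PrimeSpectrum.comap φ P))
  rw [← hcomp]
  have h4 := h1.trans h2
  rw [ENat.add_le_add_iff_right (by simp)] at h4
  exact h4.trans h3

lemma aux_adjoin_insert {R L : Type*} [CommRing R] [CommRing L] [Algebra R L] (S : Set L) (y : L) :
    ∃ φ : (Algebra.adjoin R S)[X] →+* Algebra.adjoin R (insert y S),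
      Function.Surjective φ ∧ ∀ f, (φ f : L) = Polynomial.aeval y f := by
  have h : Algebra.adjoin R (insert y S) =
      (Polynomial.aeval (R := Algebra.adjoin R S) y).range.restrictScalars R := by
    rw [← Algebra.adjoin_singleton_eq_range_aeval, ← Algebra.adjoin_union_eq_adjoin_adjoin,
      Set.union_singleton]
  refine ⟨(Polynomial.aeval (R := Algebra.adjoin R S) y).toRingHom.codRestrict
    (Algebra.adjoin R (insert y S)) ?_, ?_, fun f ↦ rfl⟩
  · intro f
    rw [h]
    exact ⟨f, rfl⟩
  · rintro ⟨x, hx⟩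
    have hx' := hx
    rw [h] at hx'
    obtain ⟨f, hf⟩ := hx'
    exact ⟨f, Subtype.ext hf⟩

lemma aux_bound_adjoin {R L : Type*} [CommRing R] [IsNoetherianRing R] [CommRing L] [Algebra R L]
    (s : L) (hs : s ∈ nonZeroDivisors L) (T : Set L) (hT : T.Finite)
    (h : ∀ y ∈ T, ∃ a : R, s * y = algebraMap R L a) :
    AuxBound R (Algebra.adjoin R (insert s T)) := by
  induction T, hT using Set.Finite.induction_on with
  | empty =>
    intro P
    let φ : R[X] →+* Algebra.adjoin R (insert s (∅ : Set L)) :=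
      (Polynomial.aeval ⟨s, Algebra.subset_adjoin (by simp)⟩ :
        R[X] →ₐ[R] Algebra.adjoin R (insert s (∅ : Set L))).toRingHom
    have hφ : Function.Surjective φ := by
      rintro ⟨x, hx⟩
      have hx' := hx
      rw [insert_empty_eq, Algebra.adjoin_singleton_eq_range_aeval] at hx'
      obtain ⟨f, hf⟩ := hx'
      refine ⟨f, Subtype.ext ?_⟩
      refine Eq.trans ?_ hf
      change (Algebra.adjoin R (insert s (∅ : Set L))).val (Polynomial.aeval _ f) = _
      rw [← Polynomial.aeval_algHom_apply]
      rfl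
    have h1 := (aux_height_comap_surj φ hφ P).trans (aux_orderHeight_polynomial_le _)
    have hc : φ.comp Polynomial.C = algebraMap R _ := by
      ext r
      simp [φ]
    rw [← hc]
    exact h1
  | @insert y T hy hTf ih =>
    have ih := ih fun z hz ↦ h z (Set.mem_insert_of_mem _ hz)
    obtain ⟨a, ha⟩ := h y (Set.mem_insert _ _)
    obtain ⟨φ, hφ, hφ'⟩ := aux_adjoin_insert (R := R) (insert s T) y
    rw [Set.insert_comm]
    have : IsNoetherianRing (Algebra.adjoin R (insert s T)) :=
      isNoetherianRing_of_fg (Subalgebra.fg_def.2 ⟨_, hTf.insert s, rfl⟩)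
    let s' : Algebra.adjoin R (insert s T) := ⟨s, Algebra.subset_adjoin (by simp)⟩
    have hs' : s' ∈ nonZeroDivisors (Algebra.adjoin R (insert s T)) := by
      rw [mem_nonZeroDivisors_iff_right]
      intro z hz
      apply Subtype.ext
      exact (mem_nonZeroDivisors_iff_right.1 hs) _ (congrArg Subtype.val hz)
    refine ih.step φ hφ ?_ (x := Polynomial.C s' * Polynomial.X -
      Polynomial.C (algebraMap R _ a)) ?_ ?_
    · ext r
      simp [hφ']
    · refine Polynomial.mem_nonzeroDivisors_of_coeff_mem 1 ?_
      simpa [Polynomial.coeff_C] using hs'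
    · apply Subtype.ext
      rw [hφ']
      simp [s', ha]


open LaurentPolynomial

lemma aux_rees_eq {R : Type*} [CommRing R] (I : Ideal R) (G : Set R) (hG : Ideal.span G = I) :
    extendedReesAlgebra R I = Algebra.adjoin R (insert (T (-1) : LaurentPolynomial R)
      ((fun a ↦ LaurentPolynomial.C a * T 1) '' G)) := by
  apply le_antisymm
  · refine Algebra.adjoin_le ?_
    rintro f (rfl | ⟨a, ha, rfl⟩)
    · exact Algebra.subset_adjoin (by simp)
    · rw [← hG] at ha
      induction ha using Submodule.span_induction with
      | mem x hx => exact Algebra.subset_adjoin (Set.mem_insert_of_mem _ ⟨x, hx, rfl⟩)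
      | zero => simp
      | add x y _ _ hx hy => rw [map_add, add_mul]; exact add_mem hx hy
      | smul r x _ hx =>
        rw [smul_eq_mul, map_mul, mul_assoc, ← LaurentPolynomial.smul_eq_C_mul]
        exact Subalgebra.smul_mem _ hx r
  · refine Algebra.adjoin_mono ?_
    rintro f (rfl | ⟨a, ha, rfl⟩)
    · exact Or.inl rfl
    · exact Or.inr ⟨a, hG ▸ Ideal.subset_span ha, rfl⟩

lemma AuxBound.congr {R L : Type*} [CommRing R] [CommRing L] [Algebra R L]
    {A B : Subalgebra R L} (h : A = B) (hB : AuxBound R B) : AuxBound R A := by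
  subst h
  exact hB

lemma aux_T_mul {R : Type*} [CommRing R] (a : R) :
    (T (-1) : LaurentPolynomial R) * (LaurentPolynomial.C a * T 1) = algebraMap R _ a := by
  rw [mul_left_comm, ← T_add, ← LaurentPolynomial.C_eq_algebraMap, neg_add_cancel, T_zero, mul_one]

lemma aux_rees_bound {R : Type*} [CommRing R] [IsNoetherianRing R] (I : Ideal R) :
    AuxBound R (extendedReesAlgebra R I) := by
  obtain ⟨G, hG⟩ := (isNoetherianRing_iff_ideal_fg R).1 ‹_› I
  have hu : (T (-1) : LaurentPolynomial R) ∈ nonZeroDivisors (LaurentPolynomial R) :=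
    (isUnit_T (-1)).mem_nonZeroDivisors
  have hfin : ((fun a : R ↦ LaurentPolynomial.C a * T 1) '' (G : Set R)).Finite :=
    G.finite_toSet.image _
  refine AuxBound.congr (aux_rees_eq I G hG) (aux_bound_adjoin (R := R) _ hu _ hfin ?_)
  rintro _ ⟨a, ha, rfl⟩
  exact ⟨a, aux_T_mul a⟩

/-- Reduction of the coefficients of a Laurent polynomial modulo an ideal. -/
noncomputable def auxPsi {R : Type*} [CommRing R] (p : Ideal R) :
    LaurentPolynomial R →+* LaurentPolynomial (R ⧸ p) :=
  AddMonoidAlgebra.mapRingHom ℤ (Ideal.Quotient.mk p)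

lemma auxPsi_C {R : Type*} [CommRing R] (p : Ideal R) (r : R) :
    auxPsi p (LaurentPolynomial.C r) = LaurentPolynomial.C (Ideal.Quotient.mk p r) :=
  AddMonoidAlgebra.mapRingHom_single _ _ _

lemma auxPsi_T {R : Type*} [CommRing R] (p : Ideal R) (n : ℤ) :
    auxPsi p (T n) = T n := by
  exact (AddMonoidAlgebra.mapRingHom_single _ _ _).trans (by rw [map_one]; rfl)

lemma auxPsi_eq_zero {R : Type*} [CommRing R] (p : Ideal R) (f : LaurentPolynomial R) :
    auxPsi p f = 0 ↔ ∀ n, f.coeff n ∈ p := by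
  constructor
  · intro h n
    have := congrArg (fun g ↦ g.coeff n) h
    simpa [auxPsi, Ideal.Quotient.eq_zero_iff_mem] using this
  · intro h
    ext n
    simpa [auxPsi, Ideal.Quotient.eq_zero_iff_mem] using h n

lemma aux_theta {R : Type*} [CommRing R] (I p : Ideal R) (hp : I ≤ p) :
    ∃ θ : extendedReesAlgebra R I →+* R ⧸ p, (∀ x : extendedReesAlgebra R I, auxPsi p x = 0 → θ x = 0) ∧
      (∀ r, θ (algebraMap R _ r) = Ideal.Quotient.mk p r) ∧
      extendedReesIdealJ R I ≤ RingHom.ker θ := by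
  let ι : (R ⧸ p)[X] →+* LaurentPolynomial (R ⧸ p) :=
    (LaurentPolynomial.invert (R := R ⧸ p)).toRingEquiv.toRingHom.comp Polynomial.toLaurent
  have hι : Function.Injective ι :=
    (LaurentPolynomial.invert (R := R ⧸ p)).injective.comp Polynomial.toLaurent_injective
  have hmem : ∀ x : extendedReesAlgebra R I, ∃ g, ι g = auxPsi p x := by
    rintro ⟨x, hx⟩
    change auxPsi p x ∈ ι.range
    induction hx using Algebra.adjoin_induction with
    | mem x hx =>
      rcases hx with rfl | ⟨a, ha, rfl⟩
      · exact ⟨X, by simp [ι, auxPsi_T]⟩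
      · rw [map_mul, auxPsi_C, Ideal.Quotient.eq_zero_iff_mem.2 (hp ha)]
        simp
    | algebraMap r => exact ⟨Polynomial.C (Ideal.Quotient.mk p r), by
        rw [← LaurentPolynomial.C_eq_algebraMap, auxPsi_C]; simp [ι]⟩
    | add x y _ _ hx hy => rw [map_add]; exact add_mem hx hy
    | mul x y _ _ hx hy => rw [map_mul]; exact mul_mem hx hy
  choose g hg using hmem
  let γ : extendedReesAlgebra R I →+* (R ⧸ p)[X] :=
    { toFun := g
      map_one' := hι (by simp [hg])
      map_zero' := hι (by simp [hg])
      map_add' := fun x y ↦ hι (by simp [hg])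
      map_mul' := fun x y ↦ hι (by simp [hg]) }
  have hγ : ∀ x, ι (γ x) = auxPsi p x := hg
  have h0 : ∀ x : extendedReesAlgebra R I, auxPsi p x = 0 → γ x = 0 := fun x hx ↦ hι (by rw [hγ, hx, map_zero])
  refine ⟨Polynomial.constantCoeff.comp γ, ?_, ?_, ?_⟩
  · intro x hx
    simp [h0 x hx]
  · intro r
    have : γ (algebraMap R _ r) = Polynomial.C (Ideal.Quotient.mk p r) := hι (by
      rw [hγ]
      change auxPsi p (algebraMap R (LaurentPolynomial R) r) = _
      rw [← LaurentPolynomial.C_eq_algebraMap, auxPsi_C]; simp [ι])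
    simp [this]
  · refine Ideal.span_le.2 ?_
    rintro x (hx | ⟨a, ha, hx⟩)
    · have : γ x = X := hι (by rw [hγ, hx]; simp [ι, auxPsi_T])
      simp [this]
    · have : γ x = 0 := h0 x (by
        rw [hx, map_mul, auxPsi_C, Ideal.Quotient.eq_zero_iff_mem.2 (hp ha)]; simp)
      simp [this]

/-- The prime `p R[t,t⁻¹] ∩ A`. -/
noncomputable def auxQ {R : Type*} [CommRing R] (I : Ideal R) (p : PrimeSpectrum R) :
    PrimeSpectrum (extendedReesAlgebra R I) :=
  ⟨RingHom.ker ((auxPsi p.asIdeal).comp (extendedReesAlgebra R I).val.toRingHom),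
    RingHom.ker_isPrime _⟩

lemma mem_auxQ {R : Type*} [CommRing R] (I : Ideal R) (p : PrimeSpectrum R)
    (x : extendedReesAlgebra R I) : x ∈ (auxQ I p).asIdeal ↔ auxPsi p.asIdeal x = 0 := Iff.rfl

lemma auxQ_strictMono {R : Type*} [CommRing R] (I : Ideal R) : StrictMono (auxQ I) := by
  have hmono : Monotone (auxQ I) := by
    intro p p' h x hx
    rw [mem_auxQ, auxPsi_eq_zero] at hx ⊢
    exact fun n ↦ h (hx n)
  refine hmono.strictMono_of_injective fun p p' h ↦ ?_
  have key : ∀ (q : PrimeSpectrum R) (r : R),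
      algebraMap R (extendedReesAlgebra R I) r ∈ (auxQ I q).asIdeal ↔ r ∈ q.asIdeal := by
    intro q r
    rw [mem_auxQ]
    change auxPsi q.asIdeal (algebraMap R (LaurentPolynomial R) r) = 0 ↔ _
    rw [← LaurentPolynomial.C_eq_algebraMap, auxPsi_C, ← Ideal.Quotient.eq_zero_iff_mem]
    constructor
    · intro h
      simpa using congrArg (fun g ↦ g.coeff 0) h
    · intro h
      rw [h, map_zero]
  ext r
  rw [← key p, ← key p', h]

lemma aux_decomp {R : Type*} [CommRing R] (I : Ideal R) (x : extendedReesAlgebra R I) :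
    ∃ r : R, x - algebraMap R _ r ∈ extendedReesIdealJ R I := by
  obtain ⟨x, hx⟩ := x
  induction hx using Algebra.adjoin_induction with
  | mem x hx =>
    refine ⟨0, ?_⟩
    rw [map_zero, sub_zero]
    apply Ideal.subset_span
    rcases hx with rfl | ⟨a, ha, rfl⟩
    · exact Or.inl rfl
    · exact Or.inr ⟨a, ha, rfl⟩
  | algebraMap r =>
    refine ⟨r, ?_⟩
    convert! Ideal.zero_mem _
    exact sub_self _
  | add x y hx hy h1 h2 =>
    obtain ⟨r, hr⟩ := h1
    obtain ⟨s, hs⟩ := h2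
    refine ⟨r + s, ?_⟩
    convert! add_mem hr hs using 1
    rw [map_add, sub_add_sub_comm]
    rfl
  | mul x y hx hy h1 h2 =>
    obtain ⟨r, hr⟩ := h1
    obtain ⟨s, hs⟩ := h2
    refine ⟨r * s, ?_⟩
    convert! add_mem (Ideal.mul_mem_right ⟨y, hy⟩ _ hr)
      (Ideal.mul_mem_left _ (algebraMap R _ r) hs) using 1
    rw [map_mul, sub_mul, mul_sub, sub_add_sub_cancel]
    rfl

end Aux

/-- Let `(R, m)` be a local equidimensional universally catenary Noetherian ring, `I` an
ideal of `R`, `A = R[It, t⁻¹] ⊆ R[t, t⁻¹]` the extended Rees algebra of `I` and `J` the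
`A`-ideal `(It, t⁻¹)`.  Then `height J = 1 + height I`. -/
theorem height_extendedReesIdeal (R : Type*) [CommRing R] [IsNoetherianRing R]
    [IsLocalRing R] (heq : IsEquidimensional R) (hucat : IsUniversallyCatenary R)
    (I : Ideal R) :
    (extendedReesIdealJ R I).heightE = 1 + I.heightE := by
  apply le_antisymm
  · unfold Ideal.heightE
    rw [add_comm]
    by_cases hI : I = ⊤
    · have : {p : PrimeSpectrum R | I ≤ p.asIdeal} = ∅ := by
        ext p
        simp [hI, p.2.ne_top]
      simp [this]
    rw [ENat.iInf_add]
    refine le_iInf fun p ↦ ?_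
    by_cases hp : I ≤ p.asIdeal
    swap
    · simp [hp]
    simp only [Set.mem_ofPred_eq, hp, iInf_pos]
    obtain ⟨θ, h1, h2, h3⟩ := aux_theta I p.asIdeal hp
    let P : PrimeSpectrum (extendedReesAlgebra R I) := ⟨RingHom.ker θ, RingHom.ker_isPrime _⟩
    refine (iInf₂_le P h3).trans ((aux_rees_bound I P).trans_eq ?_)
    congr 2
    ext r
    change θ (algebraMap R _ r) = 0 ↔ _
    rw [h2, Ideal.Quotient.eq_zero_iff_mem]
  · refine le_iInf₂ fun Q hQ ↦ ?_
    have hQ : extendedReesIdealJ R I ≤ Q.asIdeal := hQ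
    let p : PrimeSpectrum R := PrimeSpectrum.comap (algebraMap R _) Q
    have hT : (⟨LaurentPolynomial.T (-1), Algebra.subset_adjoin (Or.inl rfl)⟩ :
        extendedReesAlgebra R I) ∈ extendedReesIdealJ R I := Ideal.subset_span (Or.inl rfl)
    have hp : I ≤ p.asIdeal := by
      intro a ha
      change algebraMap R _ a ∈ Q.asIdeal
      refine hQ ?_
      convert! Ideal.mul_mem_left _ ⟨LaurentPolynomial.C a * LaurentPolynomial.T 1,
        Algebra.subset_adjoin (Or.inr ⟨a, ha, rfl⟩)⟩ hT
      apply Subtype.ext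
      change algebraMap R (LaurentPolynomial R) a = _
      exact (aux_T_mul a).symm.trans (mul_comm _ _)
    have hlt : auxQ I p < Q := by
      refine lt_of_le_of_ne ?_ ?_
      · intro x hx
        obtain ⟨θ, h1, h2, h3⟩ := aux_theta I p.asIdeal hp
        obtain ⟨r, hr⟩ := aux_decomp I x
        have h4 : θ (x - algebraMap R _ r) = 0 := h3 hr
        rw [map_sub, h1 x hx, h2, zero_sub, neg_eq_zero, Ideal.Quotient.eq_zero_iff_mem] at h4
        have h5 : algebraMap R _ r ∈ Q.asIdeal := h4
        simpa using add_mem (hQ hr) h5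
      · intro h
        have h6 := hQ hT
        rw [← h, mem_auxQ, auxPsi_T] at h6
        exact (LaurentPolynomial.isUnit_T (R := R ⧸ p.asIdeal) (-1)).ne_zero h6
    calc 1 + I.heightE ≤ 1 + Order.height p := by
          gcongr
          exact iInf₂_le p hp
      _ ≤ 1 + Order.height (auxQ I p) := by
          gcongr
          exact Order.height_le_height_apply_of_strictMono _ (auxQ_strictMono I) p
      _ ≤ Order.height Q := by
          rw [add_comm]
          exact Order.height_add_one_le hlt
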